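/- Let H be a finite extension of K such that every nonzero ideal of O_K generates a principal ideal of O_H (for instance, H containing the Hilbert class field of K), and let T be the set of maximal ideals of O_H lying above the ideals in S. Then the map φ that sends A = {[α₁:β₁],…,[α_n:β_n]} ∈ Ω_{n,K}(ℙ¹;S) to the class, modulo multiplication by units of O_H, of the binary form ∏_{i=1}^n (β_i' x − α_i' y), where for each i the pair (α_i',β_i') ∈ O_H² represents the same point of ℙ¹(H) and satisfies α_i'O_H + β_i'O_H = O_H, is well defined and injective from Ω_{n,K}(ℙ¹;S) into O_H^× \ V_n(O_H); moreover, for every A ∈ Ω_{n,K}(ℙ¹;S), the discriminant Δ(φ(A)) lies in O_{H,T}^×. -/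

import Mathlib

open Classical IsDedekindDomain NumberField
open scoped LinearAlgebra.Projectivization MatrixGroups

attribute [local instance] Ideal.Quotient.field

set_option synthInstance.maxHeartbeats 1000000
set_option maxHeartbeats 1000000

noncomputable instance projLineNonempty (F : Type*) [Field F] :
    Nonempty (ℙ F (Fin 2 → F)) :=
  ⟨Projectivization.mk F ![1, 0] (by
    intro h
    have := congrFun h 0
    simp at this)⟩

variable {K : Type*} [Field K] [NumberField K]

/-- The reduction map `ℙ¹(K) → ℙ¹(𝒪_K/𝔭)` at a maximal ideal `𝔭 = v.asIdeal`:
a point is represented by a pair of integers, not both in `𝔭`, and reduced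
coordinatewise. -/
noncomputable def redMap (v : HeightOneSpectrum (𝓞 K)) (x : ℙ K (Fin 2 → K)) :
    ℙ (𝓞 K ⧸ v.asIdeal) (Fin 2 → 𝓞 K ⧸ v.asIdeal) :=
  if h : ∃ y : ℙ (𝓞 K ⧸ v.asIdeal) (Fin 2 → 𝓞 K ⧸ v.asIdeal),
      ∃ (w : Fin 2 → 𝓞 K) (hw : (fun i => algebraMap (𝓞 K) K (w i)) ≠ 0)
        (hw' : (fun i => Ideal.Quotient.mk v.asIdeal (w i)) ≠ 0),
      x = Projectivization.mk K (fun i => algebraMap (𝓞 K) K (w i)) hw ∧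
      y = Projectivization.mk (𝓞 K ⧸ v.asIdeal) (fun i => Ideal.Quotient.mk v.asIdeal (w i)) hw'
  then h.choose
  else Classical.arbitrary _

/-- `Ω_{n,K}(ℙ¹;S)`: `n`-element subsets of `ℙ¹(K)` on which reduction at every
prime outside `S` is injective. -/
noncomputable def OmegaSet (S : Finset (HeightOneSpectrum (𝓞 K))) (n : ℕ) :
    Set (Set (ℙ K (Fin 2 → K))) :=
  {A | A.Finite ∧ A.ncard = n ∧
    ∀ v : HeightOneSpectrum (𝓞 K), v ∉ S → Set.InjOn (redMap v) A}

/-- The action of `GL₂(F)` on `ℙ¹(F)`, `[α:β] ↦ [(α,β)γ]`. -/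
noncomputable def glPt {F : Type*} [Field F] (g : GL (Fin 2) F) (x : ℙ F (Fin 2 → F)) :
    ℙ F (Fin 2 → F) :=
  Projectivization.mk F (Matrix.vecMul x.rep (g : Matrix (Fin 2) (Fin 2) F)) (by
    intro h0
    apply x.rep_nonzero
    have h2 := congrArg
      (fun u => Matrix.vecMul u ((g⁻¹ : GL (Fin 2) F) : Matrix (Fin 2) (Fin 2) F)) h0
    simp only [Matrix.vecMul_vecMul, Matrix.zero_vecMul] at h2
    rwa [← Units.val_mul, mul_inv_cancel, Units.val_one, Matrix.vecMul_one] at h2)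

/-- The inclusion `ℙ¹(K) ↪ ℙ¹(H)` induced by a field extension `K ⊆ H`. -/
noncomputable def ptMap {K H : Type*} [Field K] [Field H] [Algebra K H]
    (x : ℙ K (Fin 2 → K)) : ℙ H (Fin 2 → H) :=
  Projectivization.mk H (fun i => algebraMap K H (x.rep i)) (by
    intro h
    apply x.rep_nonzero
    funext i
    have := congrFun h i
    simpa using this)

/-- `f` is a binary form attached to `A = {[α₁:β₁],…,[αₙ:βₙ]} ∈ Ω_{n,K}(ℙ¹;S)`:
`f = ∏ (βᵢ'x − αᵢ'y)` where `(αᵢ', βᵢ') ∈ 𝒪_H²` represents the same point of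
`ℙ¹(H)` as `[αᵢ:βᵢ]` and satisfies `αᵢ'𝒪_H + βᵢ'𝒪_H = 𝒪_H`. -/
noncomputable def FormOf {K : Type*} [Field K] [NumberField K]
    (H : Type*) [Field H] [NumberField H] [Algebra K H]
    (n : ℕ) (A : Set (ℙ K (Fin 2 → K))) (f : MvPolynomial (Fin 2) (𝓞 H)) : Prop :=
  ∃ (α' β' : Fin n → 𝓞 H) (p : Fin n → ℙ K (Fin 2 → K)),
    Function.Injective p ∧ Set.range p = A ∧
    (∀ i, Ideal.span {α' i, β' i} = (⊤ : Ideal (𝓞 H))) ∧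
    (∀ i, (ptMap (H := H) (p i)).submodule =
      Submodule.span H {![algebraMap (𝓞 H) H (α' i), algebraMap (𝓞 H) H (β' i)]}) ∧
    f = ∏ i : Fin n,
      (MvPolynomial.C (β' i) * MvPolynomial.X 0 - MvPolynomial.C (α' i) * MvPolynomial.X 1)

open Projectivization in
theorem mk_eq_mk_iff_mul_eq_mul {F : Type*} [Field F] (v w : Fin 2 → F) (hv : v ≠ 0) (hw : w ≠ 0) :
    mk F v hv = mk F w hw ↔ v 0 * w 1 = v 1 * w 0 := by
  rw [mk_eq_mk_iff']
  constructor
  · rintro ⟨a, rfl⟩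
    simp only [Pi.smul_apply, smul_eq_mul]
    ring
  · intro h
    by_cases h0 : w 0 = 0
    · have h1 : w 1 ≠ 0 := fun h1 => hw (by ext i; fin_cases i <;> simp [h0, h1])
      have hv0 : v 0 = 0 := by simpa [h0, h1] using h
      refine ⟨v 1 / w 1, ?_⟩
      ext i
      fin_cases i <;> simp [h0, h1, hv0]
    · refine ⟨v 0 / w 0, ?_⟩
      ext i
      fin_cases i
      · simp [h0]
      · simp only [Pi.smul_apply, smul_eq_mul, Fin.mk_one]
        field_simp
        linear_combination h

theorem ptMap_mk {K H : Type*} [Field K] [Field H] [Algebra K H] (w : Fin 2 → K) (hw : w ≠ 0)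
    (hw' : (fun i => algebraMap K H (w i)) ≠ 0) :
    ptMap (H := H) (Projectivization.mk K w hw) =
      Projectivization.mk H (fun i => algebraMap K H (w i)) hw' := by
  have h := Projectivization.mk_rep (Projectivization.mk K w hw)
  rw [mk_eq_mk_iff_mul_eq_mul] at h
  rw [ptMap, mk_eq_mk_iff_mul_eq_mul, ← map_mul, ← map_mul, h]

theorem ptMap_injective {K H : Type*} [Field K] [Field H] [Algebra K H] :
    Function.Injective (ptMap (K := K) (H := H)) := by
  intro x y h
  rw [ptMap, ptMap, mk_eq_mk_iff_mul_eq_mul, ← map_mul, ← map_mul] at h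
  rw [← x.mk_rep, ← y.mk_rep, mk_eq_mk_iff_mul_eq_mul]
  exact (algebraMap K H).injective h

theorem exists_mul_add_mul_eq_one {R : Type*} [CommRing R] {a b : R}
    (h : Ideal.span {a, b} = (⊤ : Ideal R)) : ∃ x y, x * a + y * b = 1 :=
  Ideal.mem_span_pair.1 (h ▸ Submodule.mem_top)

theorem exists_eq_mul_of_span_eq_top {R : Type*} [CommRing R] {a b α β : R}
    (h : Ideal.span {α, β} = (⊤ : Ideal R)) (hab : a * β = b * α) :
    ∃ t, a = t * α ∧ b = t * β := by
  obtain ⟨x, y, hxy⟩ := exists_mul_add_mul_eq_one h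
  exact ⟨x * a + y * b, by linear_combination y * hab - a * hxy,
    by linear_combination -x * hab - b * hxy⟩

theorem exists_unit_of_span_eq_top {R : Type*} [CommRing R] {α β γ δ : R}
    (h : Ideal.span {α, β} = (⊤ : Ideal R)) (h' : Ideal.span {γ, δ} = (⊤ : Ideal R))
    (hab : α * δ = β * γ) : ∃ u : Rˣ, α = u * γ ∧ β = u * δ := by
  obtain ⟨t, rfl, rfl⟩ := exists_eq_mul_of_span_eq_top h' hab
  obtain ⟨x, y, hxy⟩ := exists_mul_add_mul_eq_one h
  exact ⟨Units.mkOfMulEqOne t (x * γ + y * δ) (by linear_combination hxy), rfl, rfl⟩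

theorem pair_ne_zero_of_span_eq_top {H : Type*} [Field H] [NumberField H] {α β : 𝓞 H}
    (h : Ideal.span {α, β} = (⊤ : Ideal (𝓞 H))) :
    ![algebraMap (𝓞 H) H α, algebraMap (𝓞 H) H β] ≠ 0 := by
  intro h0
  obtain ⟨x, y, hxy⟩ := exists_mul_add_mul_eq_one h
  have h1 : α = 0 := by simpa using congrFun h0 0
  have h2 : β = 0 := by simpa using congrFun h0 1
  simp [h1, h2] at hxy

theorem ptMap_eq_mk {K H : Type*} [Field K] [Field H] [NumberField H] [Algebra K H]
    {x : ℙ K (Fin 2 → K)} {α β : 𝓞 H} (h : Ideal.span {α, β} = (⊤ : Ideal (𝓞 H)))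
    (hx : (ptMap (H := H) x).submodule =
      Submodule.span H {![algebraMap (𝓞 H) H α, algebraMap (𝓞 H) H β]}) :
    ptMap (H := H) x = Projectivization.mk H _ (pair_ne_zero_of_span_eq_top h) := by
  apply Projectivization.submodule_injective
  rw [hx, Projectivization.submodule_mk]

theorem mk_pair_eq_mk_pair_iff {H : Type*} [Field H] [NumberField H]
    {α β γ δ : 𝓞 H} (h : Ideal.span {α, β} = (⊤ : Ideal (𝓞 H)))
    (h' : Ideal.span {γ, δ} = (⊤ : Ideal (𝓞 H))) :
    Projectivization.mk H _ (pair_ne_zero_of_span_eq_top h) =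
      Projectivization.mk H _ (pair_ne_zero_of_span_eq_top h') ↔ α * δ = β * γ := by
  rw [mk_eq_mk_iff_mul_eq_mul]
  simp only [Matrix.cons_val_zero, Matrix.cons_val_one]
  rw [← map_mul, ← map_mul]
  exact (FaithfulSMul.algebraMap_injective (𝓞 H) H).eq_iff

theorem eq_iff_mul_eq_mul {K H : Type*} [Field K] [Field H] [NumberField H] [Algebra K H]
    {x y : ℙ K (Fin 2 → K)} {α β γ δ : 𝓞 H} (h : Ideal.span {α, β} = (⊤ : Ideal (𝓞 H)))
    (hx : (ptMap (H := H) x).submodule =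
      Submodule.span H {![algebraMap (𝓞 H) H α, algebraMap (𝓞 H) H β]})
    (h' : Ideal.span {γ, δ} = (⊤ : Ideal (𝓞 H)))
    (hy : (ptMap (H := H) y).submodule =
      Submodule.span H {![algebraMap (𝓞 H) H γ, algebraMap (𝓞 H) H δ]}) :
    x = y ↔ α * δ = β * γ := by
  rw [← mk_pair_eq_mk_pair_iff h h', ← ptMap_eq_mk h hx, ← ptMap_eq_mk h' hy,
    ptMap_injective.eq_iff]

theorem exists_integral_rep (x : ℙ K (Fin 2 → K)) :
    ∃ (w : Fin 2 → 𝓞 K) (hw : (fun i => algebraMap (𝓞 K) K (w i)) ≠ 0),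
      x = Projectivization.mk K (fun i => algebraMap (𝓞 K) K (w i)) hw := by
  obtain ⟨b, hb⟩ := IsLocalization.exist_integer_multiples_of_finite (nonZeroDivisors (𝓞 K)) x.rep
  choose w hw using hb
  have hb0 : algebraMap (𝓞 K) K b ≠ 0 :=
    IsFractionRing.to_map_ne_zero_of_mem_nonZeroDivisors b.2
  have hw' : (fun i => algebraMap (𝓞 K) K (w i)) = algebraMap (𝓞 K) K b • x.rep := by
    ext i
    simp [hw i, Algebra.smul_def]
  have h0 : (fun i => algebraMap (𝓞 K) K (w i)) ≠ 0 := by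
    rw [hw']
    exact smul_ne_zero hb0 x.rep_nonzero
  refine ⟨w, h0, ?_⟩
  conv_lhs => rw [← x.mk_rep]
  rw [mk_eq_mk_iff_mul_eq_mul]
  have e := fun i => congrFun hw' i
  simp only [Pi.smul_apply, smul_eq_mul] at e
  rw [e, e]
  ring

/-- Every point has integral coordinates that are not both divisible by a given prime. -/
theorem exists_integral_rep_notMem (v : HeightOneSpectrum (𝓞 K)) (x : ℙ K (Fin 2 → K)) :
    ∃ (w : Fin 2 → 𝓞 K) (hw : (fun i => algebraMap (𝓞 K) K (w i)) ≠ 0),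
      (fun i => Ideal.Quotient.mk v.asIdeal (w i)) ≠ 0 ∧
      x = Projectivization.mk K (fun i => algebraMap (𝓞 K) K (w i)) hw := by
  obtain ⟨w, hw, rfl⟩ := exists_integral_rep x
  let I : Ideal (𝓞 K) := Ideal.span (Set.range w)
  have hI : I ≠ ⊥ := by
    intro h
    rw [Ideal.span_eq_bot] at h
    exact hw (by ext i; simp [h (w i) ⟨i, rfl⟩])
  have hI' : (I : FractionalIdeal (nonZeroDivisors (𝓞 K)) K) ≠ 0 :=
    FractionalIdeal.coeIdeal_ne_zero.2 hI
  have hmem : ∀ t ∈ (I : FractionalIdeal (nonZeroDivisors (𝓞 K)) K)⁻¹, ∀ i,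
      ∃ a : 𝓞 K, algebraMap (𝓞 K) K a = t * algebraMap (𝓞 K) K (w i) := by
    intro t ht i
    rw [FractionalIdeal.mem_inv_iff hI'] at ht
    exact (FractionalIdeal.mem_one_iff _).1
      (ht _ (FractionalIdeal.mem_coeIdeal_of_mem _ (Ideal.subset_span ⟨i, rfl⟩)))
  by_contra! hcon
  have hle : (I : FractionalIdeal (nonZeroDivisors (𝓞 K)) K)⁻¹ * I ≤
      (v.asIdeal : FractionalIdeal (nonZeroDivisors (𝓞 K)) K) := by
    rw [FractionalIdeal.mul_le]
    intro t ht y hy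
    obtain ⟨j, hj, rfl⟩ := (FractionalIdeal.mem_coeIdeal _).1 hy
    clear hy
    replace hj : j ∈ Submodule.span (𝓞 K) (Set.range w) := hj
    choose a ha using hmem t ht
    by_cases ht0 : t = 0
    · rw [ht0, zero_mul]
      exact FractionalIdeal.zero_mem _
    have ha' : (fun i => algebraMap (𝓞 K) K (a i)) = t • fun i => algebraMap (𝓞 K) K (w i) := by
      ext i
      simp [ha i]
    have ha0 : (fun i => algebraMap (𝓞 K) K (a i)) ≠ 0 := by
      rw [ha']
      exact smul_ne_zero ht0 hw
    have hav : ∀ i, a i ∈ v.asIdeal := by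
      by_contra! hav
      obtain ⟨i, hi⟩ := hav
      refine hcon a ha0 (fun h => hi ?_) ?_
      · exact Ideal.Quotient.eq_zero_iff_mem.1 (congrFun h i)
      · rw [mk_eq_mk_iff_mul_eq_mul, ha, ha]
        ring
    induction hj using Submodule.span_induction with
    | mem x hx =>
      obtain ⟨i, rfl⟩ := hx
      rw [← ha]
      exact FractionalIdeal.mem_coeIdeal_of_mem _ (hav i)
    | zero =>
      rw [map_zero, mul_zero]
      exact FractionalIdeal.zero_mem _
    | add x y _ _ hx hy =>
      rw [map_add, mul_add]
      exact Submodule.add_mem _ hx hy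
    | smul r x _ hx =>
      have : t * algebraMap (𝓞 K) K (r • x) = r • (t * algebraMap (𝓞 K) K x) := by
        rw [smul_eq_mul, map_mul, Algebra.smul_def]
        ring
      rw [this]
      exact Submodule.smul_mem _ _ hx
  rw [inv_mul_cancel₀ hI', ← FractionalIdeal.coeIdeal_top,
    FractionalIdeal.coeIdeal_le_coeIdeal] at hle
  exact v.isPrime.ne_top (top_le_iff.1 hle)

theorem redMap_spec (v : HeightOneSpectrum (𝓞 K)) (x : ℙ K (Fin 2 → K)) :
    ∃ (w : Fin 2 → 𝓞 K) (hw : (fun i => algebraMap (𝓞 K) K (w i)) ≠ 0)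
        (hw' : (fun i => Ideal.Quotient.mk v.asIdeal (w i)) ≠ 0),
      x = Projectivization.mk K (fun i => algebraMap (𝓞 K) K (w i)) hw ∧
      redMap v x = Projectivization.mk (𝓞 K ⧸ v.asIdeal)
        (fun i => Ideal.Quotient.mk v.asIdeal (w i)) hw' := by
  have h : ∃ y : ℙ (𝓞 K ⧸ v.asIdeal) (Fin 2 → 𝓞 K ⧸ v.asIdeal),
      ∃ (w : Fin 2 → 𝓞 K) (hw : (fun i => algebraMap (𝓞 K) K (w i)) ≠ 0)
        (hw' : (fun i => Ideal.Quotient.mk v.asIdeal (w i)) ≠ 0),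
      x = Projectivization.mk K (fun i => algebraMap (𝓞 K) K (w i)) hw ∧
      y = Projectivization.mk (𝓞 K ⧸ v.asIdeal)
        (fun i => Ideal.Quotient.mk v.asIdeal (w i)) hw' := by
    obtain ⟨w, hw, hw', hx⟩ := exists_integral_rep_notMem v x
    exact ⟨_, w, hw, hw', hx, rfl⟩
  rw [redMap, dif_pos h]
  exact h.choose_spec

theorem algebraMap_algebraMap_ringOfIntegers {K H : Type*} [Field K] [Field H]
    [Algebra K H] (a : 𝓞 K) :
    algebraMap K H (algebraMap (𝓞 K) K a) =
      algebraMap (𝓞 H) H (algebraMap (𝓞 K) (𝓞 H) a) :=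
  rfl

section CoprimeRepresentatives

variable {H : Type*} [Field H] [NumberField H] [Algebra K H]

omit [NumberField K] in
/-- Integral coordinates over `K` are an `𝓞 H`-multiple of coprime coordinates over `H`. -/
theorem exists_eq_mul_coprime_rep {w : Fin 2 → 𝓞 K}
    {hw : (fun i => algebraMap (𝓞 K) K (w i)) ≠ 0} {α β : 𝓞 H}
    (h : Ideal.span {α, β} = (⊤ : Ideal (𝓞 H)))
    (hx : (ptMap (H := H) (Projectivization.mk K (fun i => algebraMap (𝓞 K) K (w i)) hw)).submodule
      = Submodule.span H {![algebraMap (𝓞 H) H α, algebraMap (𝓞 H) H β]}) :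
    ∃ t, algebraMap (𝓞 K) (𝓞 H) (w 0) = t * α ∧ algebraMap (𝓞 K) (𝓞 H) (w 1) = t * β := by
  have e := ptMap_eq_mk h hx
  have hw' : (fun i => algebraMap K H (algebraMap (𝓞 K) K (w i))) ≠ 0 := by
    intro h0
    refine hw (funext fun i => ?_)
    simpa using congrFun h0 i
  rw [ptMap_mk _ _ hw', mk_eq_mk_iff_mul_eq_mul] at e
  refine exists_eq_mul_of_span_eq_top h (FaithfulSMul.algebraMap_injective (𝓞 H) H ?_)
  rw [map_mul, map_mul]
  exact e

theorem exists_coprime_rep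
    (hprin : ∀ I : Ideal (𝓞 K), ∃ h : 𝓞 H,
      Ideal.map (algebraMap (𝓞 K) (𝓞 H)) I = Ideal.span {h})
    (x : ℙ K (Fin 2 → K)) :
    ∃ α β : 𝓞 H, Ideal.span {α, β} = (⊤ : Ideal (𝓞 H)) ∧
      (ptMap (H := H) x).submodule =
        Submodule.span H {![algebraMap (𝓞 H) H α, algebraMap (𝓞 H) H β]} := by
  obtain ⟨w, hw, rfl⟩ := exists_integral_rep x
  have hw' : (fun i => algebraMap K H (algebraMap (𝓞 K) K (w i))) ≠ 0 := by
    intro h0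
    refine hw (funext fun i => ?_)
    simpa using congrFun h0 i
  obtain ⟨h, hh⟩ := hprin (Ideal.span {w 0, w 1})
  rw [Ideal.map_span, Set.image_pair] at hh
  obtain ⟨α, hα⟩ : h ∣ algebraMap (𝓞 K) (𝓞 H) (w 0) := by
    rw [← Ideal.mem_span_singleton, ← hh]
    exact Ideal.subset_span (by simp)
  obtain ⟨β, hβ⟩ : h ∣ algebraMap (𝓞 K) (𝓞 H) (w 1) := by
    rw [← Ideal.mem_span_singleton, ← hh]
    exact Ideal.subset_span (by simp)
  have h0 : h ≠ 0 := by
    rintro rfl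
    apply hw'
    ext i
    fin_cases i
    · simp [algebraMap_algebraMap_ringOfIntegers, hα]
    · simp [algebraMap_algebraMap_ringOfIntegers, hβ]
  have hmem : h ∈ Ideal.span {algebraMap (𝓞 K) (𝓞 H) (w 0), algebraMap (𝓞 K) (𝓞 H) (w 1)} :=
    hh ▸ Ideal.mem_span_singleton_self h
  obtain ⟨a, b, hab⟩ := Ideal.mem_span_pair.1 hmem
  have htop : Ideal.span {α, β} = (⊤ : Ideal (𝓞 H)) := by
    rw [Ideal.eq_top_iff_one, Ideal.mem_span_pair]
    refine ⟨a, b, mul_left_cancel₀ h0 ?_⟩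
    linear_combination hab - a * hα - b * hβ
  refine ⟨α, β, htop, ?_⟩
  rw [← Projectivization.submodule_mk _ (pair_ne_zero_of_span_eq_top htop), ptMap_mk _ _ hw']
  congr 1
  rw [mk_eq_mk_iff_mul_eq_mul]
  simp only [algebraMap_algebraMap_ringOfIntegers, hα, hβ, map_mul, Matrix.cons_val_zero,
    Matrix.cons_val_one]
  ring

/-- If the reductions of two points at the prime of `K` below `w` differ, then the determinant of
their coprime coordinates is not in `w`. -/
theorem det_notMem_of_redMap_ne {v : HeightOneSpectrum (𝓞 K)} {w : HeightOneSpectrum (𝓞 H)}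
    (hvw : Ideal.comap (algebraMap (𝓞 K) (𝓞 H)) w.asIdeal = v.asIdeal)
    {x y : ℙ K (Fin 2 → K)} {α β γ δ : 𝓞 H} (h : Ideal.span {α, β} = (⊤ : Ideal (𝓞 H)))
    (hx : (ptMap (H := H) x).submodule =
      Submodule.span H {![algebraMap (𝓞 H) H α, algebraMap (𝓞 H) H β]})
    (h' : Ideal.span {γ, δ} = (⊤ : Ideal (𝓞 H)))
    (hy : (ptMap (H := H) y).submodule =
      Submodule.span H {![algebraMap (𝓞 H) H γ, algebraMap (𝓞 H) H δ]})
    (hne : redMap v x ≠ redMap v y) : α * δ - γ * β ∉ w.asIdeal := by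
  obtain ⟨a, ha, ha', rfl, hax⟩ := redMap_spec v x
  obtain ⟨b, hb, hb', rfl, hby⟩ := redMap_spec v y
  obtain ⟨s, hs0, hs1⟩ := exists_eq_mul_coprime_rep h hx
  obtain ⟨t, ht0, ht1⟩ := exists_eq_mul_coprime_rep h' hy
  intro hmem
  apply hne
  rw [hax, hby, mk_eq_mk_iff_mul_eq_mul, ← map_mul, ← map_mul, Ideal.Quotient.eq, ← hvw,
    Ideal.mem_comap, map_sub, map_mul, map_mul, hs0, hs1, ht0, ht1]
  have : s * α * (t * δ) - s * β * (t * γ) = s * t * (α * δ - γ * β) := by ring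
  rw [this]
  exact Ideal.mul_mem_left _ _ hmem

theorem FormOf.exists_unit {n : ℕ} {A : Set (ℙ K (Fin 2 → K))} {f g : MvPolynomial (Fin 2) (𝓞 H)}
    (hf : FormOf H n A f) (hg : FormOf H n A g) :
    ∃ u : (𝓞 H)ˣ, f = MvPolynomial.C (u : 𝓞 H) * g := by
  obtain ⟨α, β, p, hp, hpA, hc, hs, rfl⟩ := hf
  obtain ⟨γ, δ, q, hq, hqA, hc', hs', rfl⟩ := hg
  have hex : ∀ i, ∃ j, p j = q i := fun i => by
    have : q i ∈ Set.range p := by rw [hpA, ← hqA]; exact ⟨i, rfl⟩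
    exact this
  choose σ hσ using hex
  have hσi : Function.Injective σ := fun i j hij => hq (by rw [← hσ, ← hσ, hij])
  have hσb : Function.Bijective σ := Finite.injective_iff_bijective.1 hσi
  have hu : ∀ i, ∃ u : (𝓞 H)ˣ, α (σ i) = u * γ i ∧ β (σ i) = u * δ i := fun i =>
    exists_unit_of_span_eq_top (hc _) (hc' _)
      ((eq_iff_mul_eq_mul (hc _) (hs _) (hc' _) (hs' _)).1 (hσ i))
  choose u hu0 hu1 using hu
  refine ⟨∏ i, u i, ?_⟩
  rw [← hσb.prod_comp, Units.coe_prod, map_prod, ← Finset.prod_mul_distrib]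
  refine Finset.prod_congr rfl fun i _ => ?_
  rw [hu0, hu1, map_mul, map_mul]
  ring

theorem FormOf.subset {n m : ℕ} {A B : Set (ℙ K (Fin 2 → K))}
    {f g : MvPolynomial (Fin 2) (𝓞 H)} (hf : FormOf H n A f) (hg : FormOf H m B g) {c : 𝓞 H}
    (h : g = MvPolynomial.C c * f) (hc0 : c ≠ 0) : B ⊆ A := by
  obtain ⟨α, β, p, hp, rfl, hc, hs, rfl⟩ := hf
  obtain ⟨γ, δ, q, hq, rfl, hc', hs', rfl⟩ := hg
  rintro _ ⟨i, rfl⟩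
  have e := congrArg (MvPolynomial.eval ![γ i, δ i]) h
  rw [map_mul, map_prod, map_prod, Finset.prod_eq_zero (Finset.mem_univ i) (by simp; ring),
    MvPolynomial.eval_C, eq_comm, mul_eq_zero, or_iff_right hc0, Finset.prod_eq_zero_iff] at e
  obtain ⟨j, -, hj⟩ := e
  refine ⟨j, (eq_iff_mul_eq_mul (hc _) (hs _) (hc' _) (hs' _)).2 ?_⟩
  simp at hj
  linear_combination -hj

theorem exists_unit_integer_eq (T : Set (HeightOneSpectrum (𝓞 H))) {D : 𝓞 H} (hD : D ≠ 0)
    (h : ∀ w ∉ T, D ∉ w.asIdeal) :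
    ∃ u : (↥(T.integer H))ˣ, algebraMap (𝓞 H) H D = ((u : ↥(T.integer H)) : H) := by
  have hD' : algebraMap (𝓞 H) H D ≠ 0 := by simpa using hD
  refine ⟨T.unitEquivUnitsInteger H ⟨Units.mk0 _ hD', fun w hw => ?_⟩, rfl⟩
  exact w.valuation_eq_one_iff_notMem.2 (h w hw)

end CoprimeRepresentatives

/-- Let `H/K` be such that every ideal of `𝒪_K` becomes principal
in `𝒪_H`, and `T` the set of maximal ideals of `𝒪_H` above `S`. The map `φ` sending
`A ∈ Ω_{n,K}(ℙ¹;S)` to the class modulo `𝒪_H^×` of `∏ (βᵢ'x − αᵢ'y)`, where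
`(αᵢ', βᵢ')` are coprime integral representatives of the points of `A`, is well
defined and injective into `𝒪_H^× \ V_n(𝒪_H)`; moreover `Δ(φ(A)) ∈ 𝒪_{H,T}^×`. -/
theorem coprime_form_well_defined_injective_unit_disc
    (H : Type*) [Field H] [NumberField H] [Algebra K H]
    (hprin : ∀ I : Ideal (𝓞 K), ∃ h : 𝓞 H,
      Ideal.map (algebraMap (𝓞 K) (𝓞 H)) I = Ideal.span {h})
    (S : Finset (HeightOneSpectrum (𝓞 K)))
    (T : Set (HeightOneSpectrum (𝓞 H)))
    (hT : ∀ w : HeightOneSpectrum (𝓞 H),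
      w ∈ T ↔ ∃ v ∈ S, Ideal.comap (algebraMap (𝓞 K) (𝓞 H)) w.asIdeal = v.asIdeal)
    (n : ℕ) :
    -- `φ` is defined on all of `Ω_{n,K}(ℙ¹;S)`: coprime representatives exist
    (∀ A ∈ OmegaSet S n, ∃ f, FormOf H n A f) ∧
    -- `φ` is well defined up to multiplication by a unit of `𝒪_H`
    (∀ A ∈ OmegaSet S n, ∀ f g, FormOf H n A f → FormOf H n A g →
      ∃ u : (𝓞 H)ˣ, f = MvPolynomial.C ((u : 𝓞 H)) * g) ∧
    -- `φ` is injective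
    (∀ A ∈ OmegaSet S n, ∀ B ∈ OmegaSet S n, ∀ f g, FormOf H n A f → FormOf H n B g →
      (∃ u : (𝓞 H)ˣ, f = MvPolynomial.C ((u : 𝓞 H)) * g) → A = B) ∧
    -- the discriminant of `φ(A)` is a unit of `𝒪_{H,T}`
    (∀ A ∈ OmegaSet S n, ∀ (α' β' : Fin n → 𝓞 H) (p : Fin n → ℙ K (Fin 2 → K)),
      Function.Injective p → Set.range p = A →
      (∀ i, Ideal.span {α' i, β' i} = (⊤ : Ideal (𝓞 H))) →
      (∀ i, (ptMap (H := H) (p i)).submodule =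
        Submodule.span H {![algebraMap (𝓞 H) H (α' i), algebraMap (𝓞 H) H (β' i)]}) →
      ∃ u : (↥(T.integer H))ˣ,
        algebraMap (𝓞 H) H
            (∏ i : Fin n, ∏ j ∈ Finset.Ioi i, (α' i * β' j - α' j * β' i) ^ 2)
          = ((u : ↥(T.integer H)) : H)) := by
  refine ⟨?_, ?_, ?_, ?_⟩
  · rintro A ⟨hfin, hcard, -⟩
    have : Finite A := hfin
    have hA : Nat.card A = n := hcard
    let e := (Finite.equivFinOfCardEq hA).symm
    choose α β hc hs using fun x : ℙ K (Fin 2 → K) => exists_coprime_rep (H := H) hprin x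
    refine ⟨_, fun i => α (e i), fun i => β (e i), fun i => e i,
      Subtype.val_injective.comp e.injective, ?_, fun i => hc _, fun i => hs _, rfl⟩
    have : (fun i => (e i : ℙ K (Fin 2 → K))) = Subtype.val ∘ e := rfl
    rw [this, e.surjective.range_comp, Subtype.range_coe]
  · exact fun A _ f g hf hg => hf.exists_unit hg
  · rintro A - B - f g hf hg ⟨u, hu⟩
    refine (hg.subset hf hu u.ne_zero).antisymm
      (hf.subset hg (c := ((u⁻¹ : (𝓞 H)ˣ) : 𝓞 H)) ?_ u⁻¹.ne_zero)
    rw [hu, ← mul_assoc, ← map_mul, Units.inv_mul, map_one, one_mul]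
  · rintro A ⟨-, -, hinj⟩ α β p hp rfl hc hs
    apply exists_unit_integer_eq
    · refine Finset.prod_ne_zero_iff.2 fun i _ => Finset.prod_ne_zero_iff.2 fun j hj =>
        pow_ne_zero _ fun h0 => ?_
      refine (Finset.mem_Ioi.1 hj).ne (hp ?_)
      rw [eq_iff_mul_eq_mul (hc _) (hs _) (hc _) (hs _)]
      linear_combination h0
    · intro w hw hmem
      have hmax := w.isMaximal
      let v : HeightOneSpectrum (𝓞 K) :=
        ⟨Ideal.comap (algebraMap (𝓞 K) (𝓞 H)) w.asIdeal, inferInstance,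
          fun h => w.ne_bot (Ideal.eq_bot_of_comap_eq_bot h)⟩
      have hv : v ∉ S := fun hv => hw ((hT w).2 ⟨v, hv, rfl⟩)
      obtain ⟨i, -, hi⟩ := w.isPrime.prod_mem_iff.1 hmem
      obtain ⟨j, hj, hij⟩ := w.isPrime.prod_mem_iff.1 hi
      refine det_notMem_of_redMap_ne (v := v) (w := w) rfl (hc i) (hs i) (hc j) (hs j)
        (fun h => (Finset.mem_Ioi.1 hj).ne (hp (hinj v hv ⟨i, rfl⟩ ⟨j, rfl⟩ h)))
        (w.isPrime.mem_of_pow_mem _ hij)
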